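/- arXiv:1906.06155 — 2 statements merged into one kernel-verified Lean document; each statement's English description precedes it below -/
import Mathlib

section
/- Let B be an n×n Hermitian matrix with simple eigenvalues x₁ < x₃ < ... < x_{2n-1} (the odd-indexed points), and let x₀ < x₁ < x₂ < ... < x_{2n-1} be real numbers. Then there exists a vector v ∈ ℂⁿ such that the rational function r(z) = 1 + ⟨(zI - B)⁻¹ v, v⟩ equals ∏_{i=0}^{n-1} (z - x_{2i})/(z - x_{2i+1}), i.e. r has zeros exactly at the even-indexed points x₀, x₂, ..., x_{2n-2}. -/
open Matrix Finset

lemma pf_aux {n : ℕ} (hn : 0 < n) (a b : Fin n → ℂ) (hb : Function.Injective b) (z : ℂ)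
    (hz : ∀ i, z ≠ b i) :
    ∏ i, (z - a i) / (z - b i) =
      1 + ∑ k, ((b k - a k) * ∏ i ∈ univ.erase k, (b k - a i) / (b k - b i)) / (z - b k) := by
  have hQ : Polynomial.eval z (Lagrange.nodal univ b) ≠ 0 := by
    rw [Lagrange.eval_nodal, Finset.prod_ne_zero_iff]
    exact fun i _ => sub_ne_zero.2 (hz i)
  have hdeg : (Lagrange.nodal univ a - Lagrange.nodal univ b).degree < (univ : Finset (Fin n)).card := by
    have h := Polynomial.degree_sub_lt (p := Lagrange.nodal univ a) (q := Lagrange.nodal univ b)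
      (by rw [Lagrange.degree_nodal, Lagrange.degree_nodal])
      (Lagrange.nodal_ne_zero)
      (by rw [Lagrange.nodal_monic.leadingCoeff, Lagrange.nodal_monic.leadingCoeff])
    rwa [Lagrange.degree_nodal] at h
  have hint := Lagrange.eq_interpolate_of_eval_eq (s := univ) (v := b)
    (fun k => Polynomial.eval (b k) (Lagrange.nodal univ a)) hb.injOn hdeg
    (by intro i _; simp [Lagrange.eval_nodal_at_node])
  have hev := congrArg (Polynomial.eval z) hint
  rw [Lagrange.eval_interpolate_not_at_node _ (fun i _ => hz i), Polynomial.eval_sub,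
    sub_eq_iff_eq_add] at hev
  rw [Finset.prod_div_distrib, ← Lagrange.eval_nodal, ← Lagrange.eval_nodal, hev, add_div,
    div_self hQ, mul_div_cancel_left₀ _ hQ, add_comm]
  congr 1
  refine Finset.sum_congr rfl fun k _ => ?_
  rw [Lagrange.eval_nodal, ← Finset.mul_prod_erase univ _ (mem_univ k), Lagrange.nodalWeight]
  simp only [div_eq_mul_inv, Finset.prod_mul_distrib]
  ring

theorem exists_vector_prescribed_zeros {n : ℕ} (hn : 0 < n)
    (B : Matrix (Fin n) (Fin n) ℂ) (hB : B.IsHermitian)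
    (x : Fin (2 * n) → ℝ) (hx : StrictMono x)
    (e : Fin n → (Fin n → ℂ))
    (honb : ∀ i j, star (e i) ⬝ᵥ e j = if i = j then 1 else 0)
    (heig : ∀ i : Fin n, B.mulVec (e i) =
      ((x ⟨2 * i.1 + 1, by have := i.2; omega⟩ : ℝ) : ℂ) • e i) :
    ∃ v : Fin n → ℂ, ∀ z : ℂ,
      (∀ i : Fin n, z ≠ ((x ⟨2 * i.1 + 1, by have := i.2; omega⟩ : ℝ) : ℂ)) →
      1 + star v ⬝ᵥ ((z • (1 : Matrix (Fin n) (Fin n) ℂ) - B)⁻¹.mulVec v) =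
        ∏ i : Fin n, (z - ((x ⟨2 * i.1, by have := i.2; omega⟩ : ℝ) : ℂ)) /
          (z - ((x ⟨2 * i.1 + 1, by have := i.2; omega⟩ : ℝ) : ℂ)) := by
  obtain ⟨a, ha⟩ : ∃ a : Fin n → ℝ, ∀ i : Fin n, a i = x ⟨2 * i.1, by have := i.2; omega⟩ :=
    ⟨_, fun _ => rfl⟩
  obtain ⟨b, hb⟩ : ∃ b : Fin n → ℝ, ∀ i : Fin n, b i = x ⟨2 * i.1 + 1, by have := i.2; omega⟩ :=
    ⟨_, fun _ => rfl⟩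
  simp only [← ha, ← hb] at heig ⊢
  have hab : ∀ k, a k < b k := fun k => by
    rw [ha, hb]; exact hx (by simp [Fin.lt_def])
  have hba : ∀ i k, i < k → b i < a k := fun i k h => by
    rw [ha, hb]; exact hx (by simp only [Fin.lt_def] at h ⊢; omega)
  have hbm : StrictMono b := fun i k h => (hba i k h).trans (hab k)
  obtain ⟨c, hc⟩ : ∃ c : Fin n → ℝ, ∀ k, c k =
    (b k - a k) * ∏ i ∈ univ.erase k, (b k - a i) / (b k - b i) := ⟨_, fun _ => rfl⟩
  have hc0 : ∀ k, 0 ≤ c k := by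
    intro k
    rw [hc]
    refine mul_nonneg (sub_nonneg.2 (hab k).le) (Finset.prod_nonneg fun i hi => ?_)
    rcases lt_or_gt_of_ne (Finset.ne_of_mem_erase hi) with h | h
    · have h1 := hbm h
      have h2 := hab i
      exact div_nonneg (by linarith) (by linarith)
    · have h1 := hbm h
      have h2 := hba k i h
      exact div_nonneg_of_nonpos (by linarith) (by linarith)
  let U : Matrix (Fin n) (Fin n) ℂ := Matrix.of fun i j => e j i
  have hUU : Uᴴ * U = 1 := by
    ext i j
    rw [Matrix.one_apply, ← honb i j]
    rfl
  have hUU' : U * Uᴴ = 1 := mul_eq_one_comm.1 hUU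
  have hBU : B * U = U * diagonal (fun i => (b i : ℂ)) := by
    ext i j
    rw [Matrix.mul_diagonal]
    have := congrFun (heig j) i
    simp only [Pi.smul_apply, smul_eq_mul] at this
    rw [mul_comm]
    exact this
  let s : Fin n → ℂ := fun k => ((Real.sqrt (c k) : ℝ) : ℂ)
  refine ⟨U *ᵥ s, fun z hz => ?_⟩
  have hinv : (z • (1 : Matrix (Fin n) (Fin n) ℂ) - B)⁻¹ =
      U * diagonal (fun i => (z - (b i : ℂ))⁻¹) * Uᴴ := by
    apply Matrix.inv_eq_right_inv
    have h1 : (z • (1 : Matrix (Fin n) (Fin n) ℂ) - B) * U =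
        U * diagonal (fun i => z - (b i : ℂ)) := by
      rw [sub_mul, hBU, ← Matrix.diagonal_sub, mul_sub, ← Matrix.smul_one_eq_diagonal]
      simp
    have h2 : diagonal (fun i => z - (b i : ℂ)) * diagonal (fun i => (z - (b i : ℂ))⁻¹) = 1 := by
      rw [Matrix.diagonal_mul_diagonal, ← Matrix.diagonal_one]
      congr 1
      ext i
      exact mul_inv_cancel₀ (sub_ne_zero.2 (hz i))
    rw [← mul_assoc, ← mul_assoc, h1, mul_assoc U, h2, mul_one, hUU']
  rw [hinv, pf_aux hn (fun i => (a i : ℂ)) (fun i => (b i : ℂ))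
    (fun i j h => hbm.injective (Complex.ofReal_injective h)) z hz]
  congr 1
  rw [Matrix.mulVec_mulVec, mul_assoc, hUU, mul_one, Matrix.star_mulVec, ← Matrix.mulVec_mulVec,
    Matrix.dotProduct_mulVec, Matrix.vecMul_vecMul, hUU, Matrix.vecMul_one]
  simp only [dotProduct, Matrix.mulVec_diagonal]
  refine Finset.sum_congr rfl fun k _ => ?_
  have hs : star s k * s k = (c k : ℂ) := by
    simp only [s, Pi.star_apply, RCLike.star_def, Complex.conj_ofReal]
    rw [← Complex.ofReal_mul, Real.mul_self_sqrt (hc0 k)]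
  have hck := congrArg (fun t : ℝ => (t : ℂ)) (hc k)
  push_cast at hck
  rw [← hck, ← hs, div_eq_mul_inv]
  ring
end

section
/- Let k ≥ 2. A function f : (a,b) → ℝ is k-tone (all divided differences of order k are nonnegative) if and only if f is (k-2) times continuously differentiable and f⁽ᵏ⁻²⁾ is convex on (a,b). -/
open Finset

/-- Divided difference of order `m - 1` at pairwise distinct points. -/
noncomputable def divDiff (f : ℝ → ℝ) {m : ℕ} (x : Fin m → ℝ) : ℝ :=
  ∑ i, f (x i) / ∏ j ∈ Finset.univ.erase i, (x i - x j)

/-- Divided difference over a finite set of reals. -/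
noncomputable def dd (f : ℝ → ℝ) (s : Finset ℝ) : ℝ :=
  ∑ i ∈ s, f i / ∏ j ∈ s.erase i, (i - j)

/-- `k`-tone on a set, in the finite set formulation. -/
def Tone (k : ℕ) (f : ℝ → ℝ) (I : Set ℝ) : Prop :=
  ∀ s : Finset ℝ, (s : Set ℝ) ⊆ I → s.card = k + 1 → 0 ≤ dd f s

lemma divDiff_eq_dd (f : ℝ → ℝ) {m : ℕ} (x : Fin m → ℝ) (hx : Function.Injective x) :
    divDiff f x = dd f (Finset.univ.image x) := by
  unfold divDiff dd
  rw [Finset.sum_image (fun _ _ _ _ h => hx h)]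
  refine Finset.sum_congr rfl fun i _ => ?_
  congr 1
  rw [← Finset.image_erase hx, Finset.prod_image (fun _ _ _ _ h => hx h)]

lemma tone_iff (k : ℕ) (f : ℝ → ℝ) (I : Set ℝ) :
    (∀ x : Fin (k + 1) → ℝ, (∀ i, x i ∈ I) → Function.Injective x → 0 ≤ divDiff f x) ↔
      Tone k f I := by
  constructor
  · intro h s hs hc
    have h1 := h (s.orderEmbOfFin hc) (fun i => hs (Finset.orderEmbOfFin_mem s hc i))
      (s.orderEmbOfFin hc).injective
    rw [divDiff_eq_dd _ _ (s.orderEmbOfFin hc).injective] at h1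
    simpa using h1
  · intro h x hx hinj
    rw [divDiff_eq_dd _ _ hinj]
    apply h
    · intro y hy
      simp only [Finset.coe_image, Finset.coe_univ, Set.image_univ, Set.mem_range] at hy
      obtain ⟨i, rfl⟩ := hy
      exact hx i
    · rw [Finset.card_image_of_injective _ hinj]; simp

lemma dd_poly (p : Polynomial ℝ) (s : Finset ℝ) (h : p.degree < s.card) :
    dd (fun x => p.eval x) s = p.coeff (s.card - 1) := by
  rw [Lagrange.coeff_eq_sum (v := id) (Set.injOn_id _) h]
  rfl

lemma dd_congr {f g : ℝ → ℝ} {s : Finset ℝ} (h : ∀ x ∈ s, f x = g x) : dd f s = dd g s := by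
  unfold dd
  exact Finset.sum_congr rfl fun i hi => by rw [h i hi]

lemma dd_add (f g : ℝ → ℝ) (s : Finset ℝ) : dd (fun x => f x + g x) s = dd f s + dd g s := by
  unfold dd
  rw [← Finset.sum_add_distrib]
  exact Finset.sum_congr rfl fun i hi => by rw [add_div]

lemma dd_smul (c : ℝ) (f : ℝ → ℝ) (s : Finset ℝ) : dd (fun x => c * f x) s = c * dd f s := by
  unfold dd
  rw [Finset.mul_sum]
  exact Finset.sum_congr rfl fun i hi => by rw [mul_div_assoc]

lemma dd_pow (s : Finset ℝ) (k : ℕ) (h : s.card = k + 1) : dd (fun x => x ^ k) s = 1 := by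
  have := dd_poly (Polynomial.X ^ k) s (by
    rw [Polynomial.degree_X_pow, h]; exact_mod_cast Nat.lt_succ_self k)
  simpa [h] using this

lemma dd_insert (f : ℝ → ℝ) (t : Finset ℝ) (u : ℝ) (hu : u ∉ t) :
    dd f (insert u t) = f u / ∏ j ∈ t, (u - j) +
      ∑ i ∈ t, f i / ((i - u) * ∏ j ∈ t.erase i, (i - j)) := by
  unfold dd
  rw [Finset.sum_insert hu, Finset.erase_insert hu]
  congr 1
  refine Finset.sum_congr rfl fun i hi => ?_
  have hne : u ≠ i := fun h => hu (h ▸ hi)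
  rw [Finset.erase_insert_of_ne hne, Finset.prod_insert (by simp [hu])]

lemma dd_rec (f : ℝ → ℝ) (t : Finset ℝ) (u v : ℝ) (hu : u ∉ t) (hv : v ∉ t) (huv : u ≠ v) :
    (v - u) * dd f (insert u (insert v t)) = dd f (insert v t) - dd f (insert u t) := by
  have hu' : u ∉ insert v t := by simp [hu, huv]
  have h1 : v - u ≠ 0 := sub_ne_zero.2 huv.symm
  have h2 : u - v ≠ 0 := sub_ne_zero.2 huv
  have pu : ∏ j ∈ t, (u - j) ≠ 0 :=
    Finset.prod_ne_zero_iff.2 fun j hj => sub_ne_zero.2 fun h => hu (h ▸ hj)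
  have pv : ∏ j ∈ t, (v - j) ≠ 0 :=
    Finset.prod_ne_zero_iff.2 fun j hj => sub_ne_zero.2 fun h => hv (h ▸ hj)
  rw [dd_insert f _ u hu', dd_insert f _ u hu, dd_insert f _ v hv, Finset.prod_insert hv,
    Finset.sum_insert hv, Finset.erase_insert hv]
  have key : (v - u) * ∑ i ∈ t, f i / ((i - u) * ∏ j ∈ (insert v t).erase i, (i - j)) =
      ∑ i ∈ t, f i / ((i - v) * ∏ j ∈ t.erase i, (i - j)) -
      ∑ i ∈ t, f i / ((i - u) * ∏ j ∈ t.erase i, (i - j)) := by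
    rw [← Finset.sum_sub_distrib, Finset.mul_sum]
    refine Finset.sum_congr rfl fun i hi => ?_
    have hne : v ≠ i := fun h => hv (h ▸ hi)
    have hne' : u ≠ i := fun h => hu (h ▸ hi)
    have e1 : i - v ≠ 0 := sub_ne_zero.2 hne.symm
    have e2 : i - u ≠ 0 := sub_ne_zero.2 hne'.symm
    have e3 : ∏ j ∈ t.erase i, (i - j) ≠ 0 :=
      Finset.prod_ne_zero_iff.2 fun j hj => sub_ne_zero.2 (Finset.ne_of_mem_erase hj).symm
    rw [Finset.erase_insert_of_ne hne, Finset.prod_insert (by simp [hv])]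
    field_simp
    ring
  rw [mul_add, mul_add, key]
  have e1 : (v - u) * (f u / ((u - v) * ∏ j ∈ t, (u - j))) = - (f u / ∏ j ∈ t, (u - j)) := by
    field_simp
    ring
  have e2 : (v - u) * (f v / ((v - u) * ∏ j ∈ t, (v - j))) = f v / ∏ j ∈ t, (v - j) := by
    field_simp
  rw [e1, e2]
  ring

lemma Tone.mono_aux {k : ℕ} {f : ℝ → ℝ} {I : Set ℝ} (h : Tone (k + 1) f I) (φ : ℝ → ℝ)
    (s : Finset ℝ) : ∀ t : Finset ℝ, Disjoint t s → Disjoint t (s.image φ) →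
      Disjoint s (s.image φ) → Set.InjOn φ s → (∀ x ∈ s, x < φ x) →
      (t : Set ℝ) ⊆ I → (s : Set ℝ) ⊆ I → ((s.image φ : Finset ℝ) : Set ℝ) ⊆ I →
      (t ∪ s).card = k + 1 → dd f (t ∪ s) ≤ dd f (t ∪ s.image φ) := by
  induction s using Finset.induction_on with
  | empty => intro t; simp
  | insert a s ha ih =>
    intro t d1 d2 d3 hinj hlt tI sI pI hc
    have hm : φ a ∉ s.image φ := by
      intro hm
      obtain ⟨y, hy, he⟩ := Finset.mem_image.1 hm
      have := hinj (by simp [hy]) (by simp) he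
      exact ha (this ▸ hy)
    rw [Finset.image_insert] at d2 d3 pI ⊢
    rw [Finset.disjoint_insert_right] at d1 d2
    rw [Finset.disjoint_insert_right, Finset.disjoint_insert_left] at d3
    have hφs : φ a ∉ s := fun hh => d3.1 (Finset.mem_insert_of_mem hh)
    rw [Finset.coe_insert, Set.insert_subset_iff] at sI pI
    have hat : a ∉ t ∪ s := by simp [d1.1, ha]
    have hpt : φ a ∉ t ∪ s := by simp [d2.1, hφs]
    have hc' : (t ∪ s).card = k := by
      rw [Finset.union_insert, Finset.card_insert_of_notMem hat] at hc
      omega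
    have hlt' := hlt a (by simp)
    have step : dd f (insert a (t ∪ s)) ≤ dd f (insert (φ a) (t ∪ s)) := by
      have hr := dd_rec f (t ∪ s) a (φ a) hat hpt hlt'.ne
      have h0 : 0 ≤ dd f (insert a (insert (φ a) (t ∪ s))) := by
        apply h
        · simp only [Finset.coe_insert, Finset.coe_union, Set.insert_subset_iff,
            Set.union_subset_iff]
          exact ⟨sI.1, pI.1, tI, sI.2⟩
        · rw [Finset.card_insert_of_notMem (by simp only [Finset.mem_insert, hat, or_false]; exact hlt'.ne),
            Finset.card_insert_of_notMem hpt, hc']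
      have := mul_nonneg (sub_pos.2 hlt').le h0
      linarith
    have ih' := ih (insert (φ a) t) (by rw [Finset.disjoint_insert_left]; exact ⟨hφs, d1.2⟩)
      (by rw [Finset.disjoint_insert_left]; exact ⟨hm, d2.2⟩) d3.2.2
      (hinj.mono (by simp)) (fun x hx => hlt x (by simp [hx]))
      (by rw [Finset.coe_insert, Set.insert_subset_iff]; exact ⟨pI.1, tI⟩) sI.2 pI.2
      (by rw [Finset.insert_union, Finset.card_insert_of_notMem hpt, hc'])
    rw [Finset.insert_union, Finset.insert_union] at ih'
    rw [Finset.union_insert, Finset.union_insert]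
    exact step.trans ih'

lemma Tone.mono_map {k : ℕ} {f : ℝ → ℝ} {I : Set ℝ} (h : Tone (k + 1) f I) (φ : ℝ → ℝ)
    (s : Finset ℝ) (d : Disjoint s (s.image φ)) (hinj : Set.InjOn φ s) (hlt : ∀ x ∈ s, x < φ x)
    (sI : (s : Set ℝ) ⊆ I) (pI : ((s.image φ : Finset ℝ) : Set ℝ) ⊆ I)
    (hc : s.card = k + 1) : dd f s ≤ dd f (s.image φ) := by
  simpa using h.mono_aux φ s ∅ (by simp) (by simp) d hinj hlt (by simp) sI pI (by simpa using hc)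

lemma Tone.mono_sets {k : ℕ} {f : ℝ → ℝ} {I : Set ℝ} (h : Tone (k + 1) f I)
    (s t : Finset ℝ) (hlt : ∀ x ∈ s, ∀ y ∈ t, x < y)
    (sI : (s : Set ℝ) ⊆ I) (tI : (t : Set ℝ) ⊆ I)
    (hc : s.card = k + 1) (hc' : t.card = k + 1) : dd f s ≤ dd f t := by
  let e : s ≃ t := Finset.equivOfCardEq (hc.trans hc'.symm)
  let φ : ℝ → ℝ := fun x => if hx : x ∈ s then e ⟨x, hx⟩ else x
  have hφ : ∀ x (hx : x ∈ s), φ x = e ⟨x, hx⟩ := fun x hx => by simp [φ, hx]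
  have hmem : ∀ x ∈ s, φ x ∈ t := fun x hx => by rw [hφ x hx]; exact (e _).2
  have hinj : Set.InjOn φ s := by
    intro x hx y hy hxy
    rw [hφ x hx, hφ y hy] at hxy
    have := e.injective (Subtype.ext hxy)
    simpa using this
  have himg : s.image φ = t := by
    apply Finset.eq_of_subset_of_card_le
    · intro y hy
      obtain ⟨x, hx, rfl⟩ := Finset.mem_image.1 hy
      exact hmem x hx
    · rw [Finset.card_image_of_injOn hinj, hc, hc']
  rw [← himg]
  refine h.mono_map φ s ?_ hinj (fun x hx => hlt x hx _ (hmem x hx)) sI (by rw [himg]; exact tI) hc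
  rw [himg, Finset.disjoint_left]
  exact fun x hx hx' => lt_irrefl x (hlt x hx x hx')

lemma Tone.bounded {k : ℕ} {f : ℝ → ℝ} {a b c d : ℝ} (h : Tone (k + 1) f (Set.Ioo a b))
    (hac : a < c) (hcd : c < d) (hdb : d < b) :
    ∃ M : ℝ, 0 ≤ M ∧
      ∀ s : Finset ℝ, (s : Set ℝ) ⊆ Set.Ioo c d → s.card = k + 1 → |dd f s| ≤ M := by
  obtain ⟨u, hu, hu'⟩ := (Set.Ioo_infinite hac).exists_subset_card_eq (k + 1)
  obtain ⟨v, hv, hv'⟩ := (Set.Ioo_infinite hdb).exists_subset_card_eq (k + 1)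
  refine ⟨|dd f u| + |dd f v|, by positivity, fun s hs hc => ?_⟩
  have sI : (s : Set ℝ) ⊆ Set.Ioo a b :=
    hs.trans (Set.Ioo_subset_Ioo hac.le hdb.le)
  have uI : (u : Set ℝ) ⊆ Set.Ioo a b :=
    hu.trans (Set.Ioo_subset_Ioo le_rfl (hcd.trans hdb).le)
  have vI : (v : Set ℝ) ⊆ Set.Ioo a b :=
    hv.trans (Set.Ioo_subset_Ioo (hac.trans hcd).le le_rfl)
  have h1 := h.mono_sets u s (fun x hx y hy => (hu hx).2.trans (hs hy).1) uI sI hu' hc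
  have h2 := h.mono_sets s v (fun x hx y hy => (hs hx).2.trans (hv hy).1) sI vI hc hv'
  rw [abs_le]
  constructor
  · have := neg_abs_le (dd f u)
    have := abs_nonneg (dd f v)
    linarith
  · have := le_abs_self (dd f v)
    have := abs_nonneg (dd f u)
    linarith

lemma dd_pair (f : ℝ → ℝ) (x y : ℝ) (h : y ≠ x) : dd f {y, x} = slope f x y := by
  have h1 : y - x ≠ 0 := sub_ne_zero.2 h
  have h2 : x - y ≠ 0 := sub_ne_zero.2 h.symm
  rw [dd_insert _ _ _ (by simpa using h), slope_def_field]
  simp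
  field_simp
  ring

lemma Tone.differentiableAt_three {f : ℝ → ℝ} {a b x : ℝ} (h : Tone 3 f (Set.Ioo a b))
    (hx : x ∈ Set.Ioo a b) : DifferentiableAt ℝ f x := by
  obtain ⟨c, hac, hcx⟩ := exists_between hx.1
  obtain ⟨d, hxd, hdb⟩ := exists_between hx.2
  obtain ⟨M, hM, hb⟩ := h.bounded hac (hcx.trans hxd) hdb
  have hlip : LipschitzOnWith (Real.toNNReal M) (slope f x) (Set.Ioo c d \ {x}) := by
    refine LipschitzOnWith.of_dist_le_mul fun y hy z hz => ?_
    rw [Real.coe_toNNReal _ hM, Real.dist_eq, Real.dist_eq]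
    rcases eq_or_ne z y with rfl | hne
    · simp
    have hy' : y ≠ x := hy.2
    have hz' : z ≠ x := hz.2
    have hr := dd_rec f {x} z y (by simpa using hz') (by simpa using hy') hne
    rw [dd_pair f x y hy', dd_pair f x z hz'] at hr
    rw [← hr, abs_mul, mul_comm]
    refine mul_le_mul_of_nonneg_right (hb _ ?_ ?_) (abs_nonneg _)
    · simp only [Finset.coe_insert, Finset.coe_singleton, Set.insert_subset_iff,
        Set.singleton_subset_iff]
      exact ⟨hz.1, hy.1, hcx, hxd⟩
    · rw [Finset.card_insert_of_notMem (by simp [hne, hz']), Finset.card_insert_of_notMem (by simpa using hy')]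
      simp
  obtain ⟨g, hg, hfg⟩ := hlip.extend_real
  have hd : HasDerivAt f (g x) x := by
    rw [hasDerivAt_iff_tendsto_slope]
    refine ((hg.continuous.tendsto x).mono_left nhdsWithin_le_nhds).congr' ?_
    filter_upwards [self_mem_nhdsWithin,
      mem_nhdsWithin_of_mem_nhds (Ioo_mem_nhds hcx hxd)] with y hy hy2
    exact (hfg ⟨hy2, hy⟩).symm
  exact hd.differentiableAt

lemma Tone.differentiableAt (n : ℕ) : ∀ {f : ℝ → ℝ} {a b x : ℝ},
    Tone (n + 3) f (Set.Ioo a b) → x ∈ Set.Ioo a b → DifferentiableAt ℝ f x := by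
  induction n with
  | zero => exact fun h hx => Tone.differentiableAt_three h hx
  | succ n ih =>
    intro f a b x h hx
    obtain ⟨c, hac, hcx⟩ := exists_between hx.1
    obtain ⟨d, hxd, hdb⟩ := exists_between hx.2
    obtain ⟨M, hM, hb⟩ := Tone.bounded (k := n + 3) h hac (hcx.trans hxd) hdb
    have ht : Tone (n + 3) (fun x => f x + M * x ^ (n + 3)) (Set.Ioo c d) := by
      intro s hs hc
      rw [dd_add, dd_smul, dd_pow s _ hc]
      have := (abs_le.1 (hb s hs hc)).1
      linarith
    have h1 := ih ht ⟨hcx, hxd⟩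
    have h2 : DifferentiableAt ℝ (fun x : ℝ => M * x ^ (n + 3)) x := by fun_prop
    simpa using h1.fun_sub h2

lemma dd_image_add (f : ℝ → ℝ) (s : Finset ℝ) (h : ℝ) :
    dd f (s.image (· + h)) = dd (fun x => f (x + h)) s := by
  have hinj : Function.Injective (fun x : ℝ => x + h) := add_left_injective h
  unfold dd
  rw [Finset.sum_image (fun _ _ _ _ e => hinj e)]
  refine Finset.sum_congr rfl fun i _ => ?_
  congr 1
  have := Finset.image_erase hinj s i
  rw [← this, Finset.prod_image (fun _ _ _ _ e => hinj e)]
  simp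

lemma Tone.deriv {k : ℕ} {f : ℝ → ℝ} {a b : ℝ} (h : Tone (k + 1) f (Set.Ioo a b))
    (hd : ∀ x ∈ Set.Ioo a b, DifferentiableAt ℝ f x) : Tone k (deriv f) (Set.Ioo a b) := by
  intro s hs hc
  have hlim : Filter.Tendsto (fun t : ℝ => dd (fun x => t⁻¹ * (f (x + t) + (-1) * f x)) s)
      (nhdsWithin 0 (Set.Ioi 0)) (nhds (dd (_root_.deriv f) s)) := by
    unfold dd
    refine tendsto_finsetSum _ fun i hi => Filter.Tendsto.div_const ?_ _
    have := (hd i (hs hi)).hasDerivAt.tendsto_slope_zero_right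
    simpa [sub_eq_add_neg] using this
  refine ge_of_tendsto hlim ?_
  have e1 : ∀ᶠ t in nhdsWithin (0 : ℝ) (Set.Ioi 0), ∀ x ∈ s, x + t ∈ Set.Ioo a b := by
    rw [Filter.eventually_all_finset]
    intro x hx
    have : Filter.Tendsto (fun t : ℝ => x + t) (nhds 0) (nhds x) := by
      have : Continuous (fun t : ℝ => x + t) := by fun_prop
      simpa using this.tendsto 0
    exact (this.eventually (Ioo_mem_nhds (hs hx).1 (hs hx).2)).filter_mono nhdsWithin_le_nhds
  have e2 : ∀ᶠ t in nhdsWithin (0 : ℝ) (Set.Ioi 0), ∀ x ∈ s, ∀ y ∈ s, x + t ≠ y := by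
    rw [Filter.eventually_all_finset]
    intro x hx
    rw [Filter.eventually_all_finset]
    intro y hy
    rcases le_or_gt y x with hyx | hyx
    · filter_upwards [self_mem_nhdsWithin] with t ht
      have : (0 : ℝ) < t := ht
      intro hh
      linarith
    · have : ∀ᶠ t in nhds (0 : ℝ), t < y - x := Iio_mem_nhds (sub_pos.2 hyx)
      filter_upwards [this.filter_mono nhdsWithin_le_nhds] with t ht hh
      linarith
  filter_upwards [e1, e2, self_mem_nhdsWithin] with t h1 h2 ht
  have ht : (0 : ℝ) < t := ht
  rw [dd_smul, dd_add, dd_smul, ← dd_image_add]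
  have hm := h.mono_map (· + t) s ?_ (add_left_injective t).injOn (fun x _ => by simpa using ht)
    hs ?_ hc
  · have : 0 < t⁻¹ := inv_pos.2 ht
    apply mul_nonneg this.le
    linarith
  · rw [Finset.disjoint_left]
    intro y hy hy'
    obtain ⟨x, hx, e⟩ := Finset.mem_image.1 hy'
    exact h2 x hx y hy e
  · intro y hy
    obtain ⟨x, hx, rfl⟩ := Finset.mem_image.1 (Finset.mem_coe.1 hy)
    exact h1 x hx

lemma Tone.of_deriv {k : ℕ} {f : ℝ → ℝ} {a b : ℝ}
    (hd : ∀ x ∈ Set.Ioo a b, DifferentiableAt ℝ f x) (h : Tone k (_root_.deriv f) (Set.Ioo a b)) :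
    Tone (k + 1) f (Set.Ioo a b) := by
  intro s hs hc
  set p := Lagrange.interpolate s id f with hp
  have hpe : ∀ x ∈ s, p.eval x = f x := fun x hx =>
    Lagrange.eval_interpolate_at_node (v := id) f (Set.injOn_id _) hx
  have hpd : p.degree < s.card := Lagrange.degree_interpolate_lt f (Set.injOn_id _)
  have hds : dd f s = p.coeff (k + 1) := by
    rw [← dd_congr hpe, dd_poly p s hpd, hc]
    rfl
  set x := s.orderEmbOfFin hc with hxdef
  have hxs : ∀ i, x i ∈ s := Finset.orderEmbOfFin_mem s hc
  have hex : ∀ i : Fin (k + 1), ∃ y ∈ Set.Ioo (x i.castSucc) (x i.succ),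
      _root_.deriv (fun z => f z - p.eval z) y = 0 := by
    intro i
    apply exists_deriv_eq_zero (x.strictMono (Fin.castSucc_lt_succ))
    · intro z hz
      have hzI : z ∈ Set.Ioo a b :=
        ⟨(hs (hxs _)).1.trans_le hz.1, hz.2.trans_lt (hs (hxs _)).2⟩
      exact ((hd z hzI).continuousAt.sub p.continuous.continuousAt).continuousWithinAt
    · simp [hpe _ (hxs _)]
  choose y hy hy0 using hex
  have hyI : ∀ i, y i ∈ Set.Ioo a b := fun i =>
    ⟨(hs (hxs _)).1.trans (hy i).1, (hy i).2.trans (hs (hxs _)).2⟩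
  have hymono : StrictMono y := by
    intro i j hij
    refine (hy i).2.trans_le (le_trans ?_ (hy j).1.le)
    apply x.monotone
    rw [Fin.le_def]
    simpa using hij
  set t := Finset.univ.image y with ht
  have htc : t.card = k + 1 := by
    rw [ht, Finset.card_image_of_injective _ hymono.injective]; simp
  have htI : (t : Set ℝ) ⊆ Set.Ioo a b := by
    intro z hz
    obtain ⟨i, _, rfl⟩ := Finset.mem_image.1 (Finset.mem_coe.1 hz)
    exact hyI i
  have hdt : ∀ z ∈ t, (Polynomial.derivative p).eval z = _root_.deriv f z := by
    intro z hz
    obtain ⟨i, _, rfl⟩ := Finset.mem_image.1 hz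
    have h0 := hy0 i
    rw [deriv_fun_sub (hd _ (hyI i)) p.differentiableAt, Polynomial.deriv] at h0
    linarith
  have h1 := h t htI htc
  have hdeg : (Polynomial.derivative p).degree < t.card := by
    rcases eq_or_ne p 0 with h0 | h0
    · rw [h0, htc]; simp [Polynomial.degree_zero]
    · refine (Polynomial.degree_derivative_lt h0).trans_le ?_
      rw [htc]
      rw [hc] at hpd
      exact Polynomial.degree_le_of_natDegree_le
        (Nat.lt_succ_iff.1 ((Polynomial.natDegree_lt_iff_degree_lt h0).2 hpd))
  rw [← dd_congr hdt, dd_poly _ _ hdeg, htc, Polynomial.coeff_derivative] at h1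
  rw [hds]
  have hk : (0 : ℝ) < ((k + 1 - 1 : ℕ) : ℝ) + 1 := by positivity
  exact nonneg_of_mul_nonneg_left h1 hk

lemma dd_triple (f : ℝ → ℝ) (x y z : ℝ) (hxy : x < y) (hyz : y < z) :
    (z - x) * dd f {x, y, z} = (f z - f y) / (z - y) - (f y - f x) / (y - x) := by
  have hr := dd_rec f {y} x z (by simpa using hxy.ne) (by simpa using hyz.ne') (hxy.trans hyz).ne
  rw [dd_pair f y z hyz.ne', dd_pair f y x hxy.ne, slope_comm f y x, slope_def_field,
    slope_def_field] at hr
  rw [← hr, Finset.pair_comm y z]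

lemma tone_two_iff (f : ℝ → ℝ) (a b : ℝ) :
    Tone 2 f (Set.Ioo a b) ↔ ConvexOn ℝ (Set.Ioo a b) f := by
  constructor
  · intro h
    apply convexOn_of_slope_mono_adjacent (convex_Ioo a b)
    intro x y z hx hz hxy hyz
    have ht := dd_triple f x y z hxy hyz
    have h0 : 0 ≤ dd f {x, y, z} := by
      apply h
      · simp only [Finset.coe_insert, Finset.coe_singleton, Set.insert_subset_iff,
          Set.singleton_subset_iff]
        exact ⟨hx, ⟨hx.1.trans hxy, hyz.trans hz.2⟩, hz⟩
      · exact Finset.card_eq_three.2 ⟨x, y, z, hxy.ne, (hxy.trans hyz).ne, hyz.ne, rfl⟩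
    have := mul_nonneg (sub_pos.2 (hxy.trans hyz)).le h0
    linarith
  · intro h s hs hc
    set e := s.orderEmbOfFin hc with he
    have h01 : e 0 < e 1 := e.strictMono (by decide)
    have h12 : e 1 < e 2 := e.strictMono (by decide)
    have hse : s = {e 0, e 1, e 2} := by
      have : Finset.univ.image e = s := by simp [he]
      rw [← this]
      ext z
      simp [Fin.exists_fin_succ, eq_comm]
    have ht := dd_triple f _ _ _ h01 h12
    rw [← hse] at ht
    have := h.slope_mono_adjacent (hs (Finset.orderEmbOfFin_mem s hc 0))
      (hs (Finset.orderEmbOfFin_mem s hc 2)) h01 h12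
    have h2 : 0 ≤ (e 2 - e 0) * dd f s := by rw [ht]; linarith
    exact nonneg_of_mul_nonneg_right h2 (sub_pos.2 (h01.trans h12))

lemma Tone.congr {k : ℕ} {f g : ℝ → ℝ} {I : Set ℝ} (h : Set.EqOn f g I) (hf : Tone k f I) :
    Tone k g I := by
  intro s hs hc
  rw [← dd_congr fun x hx => h (hs hx)]
  exact hf s hs hc

lemma main_aux (n : ℕ) : ∀ (a b : ℝ) (f : ℝ → ℝ), Tone (n + 2) f (Set.Ioo a b) ↔
    ContDiffOn ℝ n f (Set.Ioo a b) ∧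
      ConvexOn ℝ (Set.Ioo a b) (iteratedDerivWithin n f (Set.Ioo a b)) := by
  induction n with
  | zero =>
    intro a b f
    rw [iteratedDerivWithin_zero, tone_two_iff]
    constructor
    · intro h
      exact ⟨by simpa using h.continuousOn isOpen_Ioo, h⟩
    · exact fun h => h.2
  | succ n ih =>
    intro a b f
    have e1 : ∀ x ∈ Set.Ioo a b, derivWithin f (Set.Ioo a b) x = deriv f x :=
      fun x hx => derivWithin_of_isOpen isOpen_Ioo hx
    rw [iteratedDerivWithin_succ']
    have e2 : ContDiffOn ℝ ((n + 1 : ℕ) : WithTop ℕ∞) f (Set.Ioo a b) ↔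
        DifferentiableOn ℝ f (Set.Ioo a b) ∧
          ContDiffOn ℝ n (derivWithin f (Set.Ioo a b)) (Set.Ioo a b) := by
      have := contDiffOn_succ_iff_derivWithin (𝕜 := ℝ) (n := (n : WithTop ℕ∞)) (f := f)
        (isOpen_Ioo (a := a) (b := b)).uniqueDiffOn
      push_cast
      rw [this]
      simp
    rw [e2, and_assoc, ← ih a b (derivWithin f (Set.Ioo a b))]
    constructor
    · intro h
      have hd : ∀ x ∈ Set.Ioo a b, DifferentiableAt ℝ f x := fun x hx =>
        Tone.differentiableAt n h hx
      exact ⟨fun x hx => (hd x hx).differentiableWithinAt,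
        (Tone.deriv (k := n + 2) h hd).congr fun x hx => (e1 x hx).symm⟩
    · rintro ⟨hd, h⟩
      exact Tone.of_deriv (k := n + 2)
        (fun x hx => (hd x hx).differentiableAt (Ioo_mem_nhds hx.1 hx.2)) (h.congr e1)

theorem kTone_iff_contDiff_convex (k : ℕ) (hk : 2 ≤ k) (a b : ℝ) (hab : a < b) (f : ℝ → ℝ) :
    (∀ x : Fin (k + 1) → ℝ, (∀ i, x i ∈ Set.Ioo a b) → Function.Injective x →
        0 ≤ divDiff f x) ↔
      ContDiffOn ℝ (k - 2 : ℕ) f (Set.Ioo a b) ∧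
        ConvexOn ℝ (Set.Ioo a b) (iteratedDerivWithin (k - 2) f (Set.Ioo a b)) := by
  obtain ⟨n, rfl⟩ := Nat.exists_eq_add_of_le' hk
  rw [tone_iff, Nat.add_sub_cancel]
  exact main_aux n a b f
end
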